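/- arXiv:1807.03294 — 2 statements merged into one kernel-verified Lean document; each statement's English description precedes it below -/
import Mathlib

section
/- Let λ be a partition with at most n rows. The map Θ defined by Θ(T) = {(i, i + c − r) : T has a box in row r, column c whose set contains the entry i} is a bijection from SVT^n(λ) onto EYD^n(λ), the set of excited Young diagrams of shape λ. -/
open scoped Classical

noncomputable section

namespace SVTCrystal

/-- A filling assigns to each (row, column) position (0-indexed) a finite set of entries. -/
abbrev Filling : Type := ℕ → ℕ → Finset ℕ

/-- `lam` is a partition shape with at most `n` rows. -/
def IsPartitionShape (n : ℕ) (lam : ℕ → ℕ) : Prop :=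
  (∀ r, lam (r + 1) ≤ lam r) ∧ (∀ r, n ≤ r → lam r = 0)

/-- Semistandard set-valued tableau of shape `lam` with entries in `{1,…,n}`. -/
structure IsSVT (n : ℕ) (lam : ℕ → ℕ) (t : Filling) : Prop where
  boxNonempty : ∀ r c, c < lam r → (t r c).Nonempty
  emptyOutside : ∀ r c, ¬ c < lam r → t r c = ∅
  entryBounds : ∀ r c a, a ∈ t r c → 1 ≤ a ∧ a ≤ n
  rowWeak : ∀ r c a b, a ∈ t r c → b ∈ t r (c + 1) → a ≤ b
  colStrict : ∀ r c a b, a ∈ t r c → b ∈ t (r + 1) c → a < b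

/-- Semistandard Young tableau: a set-valued tableau all of whose boxes are singletons. -/
def IsSSYT (n : ℕ) (lam : ℕ → ℕ) (t : Filling) : Prop :=
  IsSVT n lam t ∧ ∀ r c, c < lam r → (t r c).card = 1

/-- The weight: `wt n lam t j` is the number of boxes of `t` containing the entry `j`. -/
def wt (n : ℕ) (lam : ℕ → ℕ) (t : Filling) (j : ℕ) : ℕ :=
  ((Finset.range n ×ˢ Finset.range (lam 0)).filter (fun p => j ∈ t p.1 p.2)).card

/-- The excess: total number of extra entries. -/
def excess (n : ℕ) (lam : ℕ → ℕ) (t : Filling) : ℕ :=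
  ∑ p ∈ Finset.range n ×ˢ Finset.range (lam 0), ((t p.1 p.2).card - 1)

/-- Column `c` contains the entry `a`. -/
def colHas (n : ℕ) (t : Filling) (a c : ℕ) : Prop := ∃ r, r < n ∧ a ∈ t r c

/-- The sign of column `c` for the `i`-signature rule: `+` (true) if the column contains `i`
but not `i+1`, `-` (false) if it contains `i+1` but not `i`. -/
def colSign (n : ℕ) (t : Filling) (i c : ℕ) : Option Bool :=
  if colHas n t i c ∧ ¬ colHas n t (i + 1) c then some true
  else if colHas n t (i + 1) c ∧ ¬ colHas n t i c then some false
  else none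

/-- The number of `-` (false) signs left uncanceled after scanning the word left-to-right,
iteratively canceling `-+` pairs. -/
def mctr (w : List Bool) : ℕ := w.foldl (fun cnt b => if b then cnt - 1 else cnt + 1) 0

/-- The number of `+` (true) signs left uncanceled, scanning right-to-left. -/
def pctr (w : List Bool) : ℕ := w.foldr (fun b cnt => if b then cnt + 1 else cnt - 1) 0

/-- The word of column signs of the columns before column `c`. -/
def colWordBefore (n : ℕ) (t : Filling) (i c : ℕ) : List Bool :=
  (List.range c).filterMap (colSign n t i)

/-- The word of column signs of the columns after column `c` (among columns `< ncols`). -/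
def colWordAfter (n ncols : ℕ) (t : Filling) (i c : ℕ) : List Bool :=
  ((List.range ncols).drop (c + 1)).filterMap (colSign n t i)

/-- Column `c` carries an uncanceled `+` for the `i`-signature rule. -/
def PlusCol (n ncols : ℕ) (t : Filling) (i c : ℕ) : Prop :=
  c < ncols ∧ colSign n t i c = some true ∧ mctr (colWordBefore n t i c) = 0

/-- Column `c` carries an uncanceled `-` for the `i`-signature rule. -/
def MinusCol (n ncols : ℕ) (t : Filling) (i c : ℕ) : Prop :=
  c < ncols ∧ colSign n t i c = some false ∧ pctr (colWordAfter n ncols t i c) = 0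

/-- Column `c` is the rightmost uncanceled `+`. -/
def fBoxCol (n ncols : ℕ) (t : Filling) (i c : ℕ) : Prop :=
  PlusCol n ncols t i c ∧ ∀ c', PlusCol n ncols t i c' → c' ≤ c

/-- Column `c` is the leftmost uncanceled `-`. -/
def eBoxCol (n ncols : ℕ) (t : Filling) (i c : ℕ) : Prop :=
  MinusCol n ncols t i c ∧ ∀ c', MinusCol n ncols t i c' → c ≤ c'

/-- Replace the content of the box in row `r`, column `c` by `A`. -/
def updateBox (t : Filling) (r c : ℕ) (A : Finset ℕ) : Filling :=
  fun r' c' => if r' = r ∧ c' = c then A else t r' c'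

/-- The set-valued crystal operator `f_i` (signature rule). -/
def fRaw (n : ℕ) (lam : ℕ → ℕ) (i : ℕ) (t : Filling) : Option Filling :=
  if h : ∃ c, fBoxCol n (lam 0) t i c then
    let c := Classical.choose h
    if hr : ∃ r, r < n ∧ i ∈ t r c then
      let r := Classical.choose hr
      if i ∈ t r (c + 1) then
        some (updateBox (updateBox t r (c + 1) ((t r (c + 1)).erase i)) r c
          (insert (i + 1) (t r c)))
      else some (updateBox t r c (insert (i + 1) ((t r c).erase i)))
    else none
  else none

/-- The set-valued crystal operator `e_i` (signature rule). -/
def eRaw (n : ℕ) (lam : ℕ → ℕ) (i : ℕ) (t : Filling) : Option Filling :=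
  if h : ∃ c, eBoxCol n (lam 0) t i c then
    let c := Classical.choose h
    if hr : ∃ r, r < n ∧ (i + 1) ∈ t r c then
      let r := Classical.choose hr
      if 0 < c ∧ (i + 1) ∈ t r (c - 1) then
        some (updateBox (updateBox t r (c - 1) ((t r (c - 1)).erase (i + 1))) r c
          (insert i (t r c)))
      else some (updateBox t r c (insert i ((t r c).erase (i + 1))))
    else none
  else none

/-- Iterate a partially-defined operator. -/
def iterOpt (g : Filling → Option Filling) : ℕ → Filling → Option Filling
  | 0, t => some t
  | m + 1, t => (iterOpt g m t).bind g

/-- Highest weight (Yamanouchi) elements. -/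
def IsYamanouchi (n : ℕ) (lam : ℕ → ℕ) (t : Filling) : Prop :=
  ∀ i, 1 ≤ i → i < n → eRaw n lam i t = none

/-- Closure of `t0` under the crystal operators `e_i`, `f_i` for `1 ≤ i < n`. -/
inductive Reach (n : ℕ) (lam : ℕ → ℕ) (t0 : Filling) : Filling → Prop
  | base : Reach n lam t0 t0
  | stepF : ∀ {t t' : Filling} (i : ℕ), 1 ≤ i → i < n → Reach n lam t0 t →
      fRaw n lam i t = some t' → Reach n lam t0 t'
  | stepE : ∀ {t t' : Filling} (i : ℕ), 1 ≤ i → i < n → Reach n lam t0 t →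
      eRaw n lam i t = some t' → Reach n lam t0 t'

/-- The one-row partition `(s)`. -/
def rowShape (s : ℕ) : ℕ → ℕ := fun r => if r = 0 then s else 0

/-- The one-column partition `(1^k)`. -/
def colShape (k : ℕ) : ℕ → ℕ := fun r => if r < k then 1 else 0

/-- The hook partition `(s, 1^e)`. -/
def hookShape (s e : ℕ) : ℕ → ℕ := fun r => if r = 0 then s else if r ≤ e then 1 else 0

/-! ### K-theory crystal operators (for single rows and single columns) -/

/-- Some box of the tableau contains the entry `a`. -/
def containsEntry (n : ℕ) (lam : ℕ → ℕ) (t : Filling) (a : ℕ) : Prop :=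
  ∃ r c, r < n ∧ c < lam r ∧ a ∈ t r c

/-- `p` is the rightmost box of `t` containing `i`. -/
def KBoxF (n : ℕ) (lam : ℕ → ℕ) (t : Filling) (i : ℕ) (p : ℕ × ℕ) : Prop :=
  p.1 < n ∧ p.2 < lam p.1 ∧ i ∈ t p.1 p.2 ∧
    ∀ q : ℕ × ℕ, q.1 < n → q.2 < lam q.1 → i ∈ t q.1 q.2 → q.2 ≤ p.2

/-- The K-crystal operator `f_i^K`: if `i` occurs in `t` and `i+1` does not, add `i+1` to
the rightmost box containing `i`; otherwise `0`. -/
def fK (n : ℕ) (lam : ℕ → ℕ) (i : ℕ) (t : Filling) : Option Filling :=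
  if h : (∃ p : ℕ × ℕ, KBoxF n lam t i p) ∧ ¬ containsEntry n lam t (i + 1) then
    let p := Classical.choose h.1
    some (updateBox t p.1 p.2 (insert (i + 1) (t p.1 p.2)))
  else none

/-- The K-crystal operator `e_i^K`: delete `i+1` from the box containing both `i` and `i+1`,
if such a box exists; otherwise `0`. -/
def eK (n : ℕ) (lam : ℕ → ℕ) (i : ℕ) (t : Filling) : Option Filling :=
  if h : ∃ p : ℕ × ℕ, p.1 < n ∧ p.2 < lam p.1 ∧ i ∈ t p.1 p.2 ∧ (i + 1) ∈ t p.1 p.2 then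
    let p := Classical.choose h
    some (updateBox t p.1 p.2 ((t p.1 p.2).erase (i + 1)))
  else none

/-- `t'` is the result of applying `g` to `t` as many times as possible. -/
def MaxApply (g : Filling → Option Filling) (t t' : Filling) : Prop :=
  (∃ m, iterOpt g m t = some t') ∧ g t' = none

/-- One Demazure step: apply `e_i` as many times as possible, then `e_i^K` as many times
as possible (here `eKop i` is the `i`-th K-operator). -/
def DemStep (n : ℕ) (lam : ℕ → ℕ) (eKop : ℕ → Filling → Option Filling) (i : ℕ)
    (t t' : Filling) : Prop :=
  ∃ t1, MaxApply (eRaw n lam i) t t1 ∧ MaxApply (eKop i) t1 t'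

/-- `DemReach n lam eKop [i₁,…,iℓ] t u` holds when
`u = (e_{iℓ}^K)^max e_{iℓ}^max ⋯ (e_{i₁}^K)^max e_{i₁}^max t`. -/
def DemReach (n : ℕ) (lam : ℕ → ℕ) (eKop : ℕ → Filling → Option Filling) :
    List ℕ → Filling → Filling → Prop
  | [], t, u => t = u
  | i :: rest, t, u => ∃ t2, DemStep n lam eKop i t t2 ∧ DemReach n lam eKop rest t2 u

/-- The minimal highest weight tableau `u_λ`, whose row `r` boxes are all `{r+1}`. -/
def uTab (lam : ℕ → ℕ) : Filling := fun r c => if c < lam r then {r + 1} else ∅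

/-- The K-Demazure crystal associated with a word `[i₁,…,iℓ]`. -/
def KDem (n : ℕ) (lam : ℕ → ℕ) (eKop : ℕ → Filling → Option Filling) (word : List ℕ) :
    Set Filling :=
  {t | IsSVT n lam t ∧ DemReach n lam eKop word t (uTab lam)}

/-! ### Permutations and reduced words -/

/-- The permutation `s_{i₁} ⋯ s_{iℓ}` of a word `[i₁,…,iℓ]`, where `s_i` swaps `i`, `i+1`. -/
def wordPerm (word : List ℕ) : Equiv.Perm ℕ :=
  (word.map fun i => Equiv.swap i (i + 1)).prod

/-- `word` is a reduced word for `w` in the Coxeter generators `s_1, …, s_{n-1}`. -/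
def IsReducedWord (n : ℕ) (w : Equiv.Perm ℕ) (word : List ℕ) : Prop :=
  (∀ i ∈ word, 1 ≤ i ∧ i < n) ∧ wordPerm word = w ∧
    ∀ word' : List ℕ, (∀ i ∈ word', 1 ≤ i ∧ i < n) → wordPerm word' = w →
      word.length ≤ word'.length

/-- The Coxeter length of a permutation of `{1,…,n}`. -/
def permLength (n : ℕ) (σ : Equiv.Perm ℕ) : ℕ :=
  sInf {l | ∃ word : List ℕ, (∀ i ∈ word, 1 ≤ i ∧ i < n) ∧ wordPerm word = σ ∧
    word.length = l}

/-- The parabolic subgroup generated by `s_2, …, s_{n-1}`. -/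
def parabolic (n : ℕ) : Subgroup (Equiv.Perm ℕ) :=
  Subgroup.closure {σ | ∃ i, 2 ≤ i ∧ i < n ∧ σ = Equiv.swap i (i + 1)}

/-! ### Polynomials -/

/-- Polynomials in `x₁, x₂, …` over `ℤ[β]`; the variable `β` is `Polynomial.X`. -/
abbrev KPoly : Type := MvPolynomial ℕ (Polynomial ℤ)

/-- The scalar `β`. -/
def betaP : KPoly := MvPolynomial.C Polynomial.X

/-- The monomial `x^{wt(T)} = x₁^{wt₁} ⋯ xₙ^{wtₙ}`. -/
def xwt (n : ℕ) (lam : ℕ → ℕ) (t : Filling) : KPoly :=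
  ∏ j ∈ Finset.Icc 1 n, (MvPolynomial.X j : KPoly) ^ wt n lam t j

/-- The β-character `∑_{T ∈ S} β^{excess T} x^{wt T}` of a set of tableaux. -/
def charSet (n : ℕ) (lam : ℕ → ℕ) (S : Set Filling) : KPoly :=
  ∑ᶠ t ∈ S, betaP ^ excess n lam t * xwt n lam t

/-- The symmetric Grothendieck polynomial `𝔊_λ(x₁,…,xₙ; β)`. -/
def Groth (n : ℕ) (lam : ℕ → ℕ) : KPoly :=
  charSet n lam {t | IsSVT n lam t}

/-- The Schur polynomial `s_μ(x₁,…,xₙ)`. -/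
def SchurP (n : ℕ) (mu : ℕ → ℕ) : KPoly :=
  ∑ᶠ t ∈ {t : Filling | IsSSYT n mu t}, xwt n mu t

/-- The numerator defining the Demazure–Lascoux operator `ϖ_i`. -/
def DLnum (i : ℕ) (f : KPoly) : KPoly :=
  (MvPolynomial.X i + betaP * MvPolynomial.X i * MvPolynomial.X (i + 1)) * f -
    (MvPolynomial.X (i + 1) + betaP * MvPolynomial.X i * MvPolynomial.X (i + 1)) *
      (MvPolynomial.rename (Equiv.swap i (i + 1)) f)

/-- `DL` implements the Demazure–Lascoux operators `ϖ_i` for `1 ≤ i < n`: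
`(x_i - x_{i+1}) · ϖ_i f` equals the defining numerator. -/
def IsDLOp (n : ℕ) (DL : ℕ → KPoly → KPoly) : Prop :=
  ∀ i, 1 ≤ i → i < n → ∀ f : KPoly,
    (MvPolynomial.X i - MvPolynomial.X (i + 1)) * DL i f = DLnum i f

/-- `applyDL DL [i₁,…,iℓ] f = ϖ_{i₁} ϖ_{i₂} ⋯ ϖ_{iℓ} f`. -/
def applyDL (DL : ℕ → KPoly → KPoly) : List ℕ → KPoly → KPoly
  | [], f => f
  | i :: rest, f => DL i (applyDL DL rest f)

/-- An elementary excitation step on subsets of `{1,…,n} × ℤ_{>0}`: if `(i,j)` is present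
and `(i,j+1)`, `(i+1,j)`, `(i+1,j+1)` are absent (with `i+1 ≤ n`), then either move
`(i,j)` to `(i+1,j+1)` (Type 1) or add `(i+1,j+1)` keeping `(i,j)` (Type 2). -/
def ExcStep (n : ℕ) (E E' : Finset (ℕ × ℕ)) : Prop :=
  ∃ i j, (i, j) ∈ E ∧ i + 1 ≤ n ∧ (i, j + 1) ∉ E ∧ (i + 1, j) ∉ E ∧ (i + 1, j + 1) ∉ E ∧
    (E' = insert (i + 1, j + 1) (E.erase (i, j)) ∨ E' = insert (i + 1, j + 1) E)

/-- The (1-indexed) Young diagram of `λ` as a finite set of positions. -/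
def ydFinset (n : ℕ) (lam : ℕ → ℕ) : Finset (ℕ × ℕ) :=
  ((Finset.Icc 1 n) ×ˢ (Finset.Icc 1 (lam 0))).filter fun p => p.2 ≤ lam (p.1 - 1)

/-- The excited Young diagrams of shape `λ`: all sets obtainable from the Young diagram of
`λ` by finite sequences of elementary excitations. -/
def EYD (n : ℕ) (lam : ℕ → ℕ) : Set (Finset (ℕ × ℕ)) :=
  {E | Relation.ReflTransGen (ExcStep n) (ydFinset n lam) E}

/-- The map `Θ`, sending `T` to `{(i, i + c - r) : i ∈ T(r,c)}` (1-indexed rows/columns). -/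
def Theta (n : ℕ) (lam : ℕ → ℕ) (t : Filling) : Finset (ℕ × ℕ) :=
  (Finset.range n ×ˢ Finset.range (lam 0)).biUnion fun p =>
    (t p.1 p.2).image fun a => (a, a + p.2 - p.1)

lemma IsPartitionShape.antitone {n : ℕ} {lam : ℕ → ℕ} (h : IsPartitionShape n lam) :
    Antitone lam := antitone_nat_of_succ_le h.1

lemma IsPartitionShape.row_lt {n : ℕ} {lam : ℕ → ℕ} (h : IsPartitionShape n lam) {r c : ℕ}
    (hc : c < lam r) : r < n := by
  by_contra hr
  have := h.2 r (by omega)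
  omega

namespace IsSVT

variable {n : ℕ} {lam : ℕ → ℕ} {t t' : Filling}

lemma col_lt (ht : IsSVT n lam t) {r c a : ℕ} (ha : a ∈ t r c) : c < lam r := by
  by_contra h
  rw [ht.emptyOutside r c h] at ha
  simp at ha

lemma le_of_mem_row (ht : IsSVT n lam t) {r c a b : ℕ} (k : ℕ) (hk : 0 < k) (ha : a ∈ t r c)
    (hb : b ∈ t r (c + k)) : a ≤ b := by
  induction k, hk using Nat.le_induction generalizing b with
  | base => exact ht.rowWeak r c a b ha hb
  | succ k hk ih =>
    have hlt := ht.col_lt hb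
    obtain ⟨x, hx⟩ := ht.boxNonempty r (c + k) (by omega)
    exact (ih hx).trans (ht.rowWeak r (c + k) x b hx hb)

lemma add_le_of_mem_col (hlam : IsPartitionShape n lam) (ht : IsSVT n lam t) {r c a b : ℕ}
    (k : ℕ) (hk : 0 < k) (ha : a ∈ t r c) (hb : b ∈ t (r + k) c) : a + k ≤ b := by
  induction k, hk using Nat.le_induction generalizing b with
  | base => exact ht.colStrict r c a b ha hb
  | succ k hk ih =>
    obtain ⟨x, hx⟩ := ht.boxNonempty (r + k) c
      ((ht.col_lt hb).trans_le (hlam.antitone (by omega)))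
    have h₁ := ih hx
    have h₂ := ht.colStrict (r + k) c x b hx hb
    omega

/-- Entries weakly increase to the south-east, and gain at least one with every row. -/
lemma entry_mono (hlam : IsPartitionShape n lam) (ht : IsSVT n lam t) {r c r' c' a b : ℕ}
    (hr : r ≤ r') (hc : c ≤ c') (hne : r < r' ∨ c < c') (ha : a ∈ t r c) (hb : b ∈ t r' c') :
    a + r' ≤ b + r := by
  obtain ⟨k, rfl⟩ := Nat.exists_eq_add_of_le hr
  obtain ⟨l, rfl⟩ := Nat.exists_eq_add_of_le hc
  rcases Nat.eq_zero_or_pos k with rfl | hk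
  · have := ht.le_of_mem_row l (by omega) ha hb
    omega
  · rcases Nat.eq_zero_or_pos l with rfl | hl
    · have := add_le_of_mem_col hlam ht k hk ha hb
      omega
    · have hlt := ht.col_lt hb
      obtain ⟨x, hx⟩ := ht.boxNonempty (r + k) c (by omega)
      have h₁ := add_le_of_mem_col hlam ht k hk ha hx
      have h₂ := ht.le_of_mem_row l hl hx hb
      omega

lemma row_lt_entry (hlam : IsPartitionShape n lam) (ht : IsSVT n lam t) {r c a : ℕ}
    (ha : a ∈ t r c) : r < a := by
  rcases Nat.eq_zero_or_pos r with rfl | hr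
  · exact (ht.entryBounds 0 c a ha).1
  · obtain ⟨x, hx⟩ := ht.boxNonempty 0 c ((ht.col_lt ha).trans_le (hlam.antitone hr.le))
    have h₁ := (ht.entryBounds 0 c x hx).1
    have h₂ := ht.entry_mono hlam hr.le le_rfl (Or.inl hr) hx ha
    omega

/-- An entry occurs at most once on each diagonal. -/
lemma diagonal_unique (hlam : IsPartitionShape n lam) (ht : IsSVT n lam t) {r c r' c' a : ℕ}
    (ha : a ∈ t r c) (ha' : a ∈ t r' c') (hd : c + r' = c' + r) : r' = r ∧ c' = c := by
  rcases lt_trichotomy r r' with h | h | h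
  · have := ht.entry_mono hlam h.le (by omega) (Or.inl h) ha ha'
    omega
  · omega
  · have := ht.entry_mono hlam h.le (by omega) (Or.inl h) ha' ha
    omega

lemma mem_Theta (hlam : IsPartitionShape n lam) (ht : IsSVT n lam t) {i j : ℕ} :
    (i, j) ∈ Theta n lam t ↔ ∃ r c, i ∈ t r c ∧ j + r = i + c := by
  simp only [Theta, Finset.mem_biUnion, Finset.mem_product, Finset.mem_range, Finset.mem_image,
    Prod.exists, Prod.mk.injEq]
  constructor
  · rintro ⟨r, c, -, a, ha, rfl, rfl⟩
    have := ht.row_lt_entry hlam ha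
    exact ⟨r, c, ha, by omega⟩
  · rintro ⟨r, c, ha, hj⟩
    have hc := ht.col_lt ha
    exact ⟨r, c, ⟨hlam.row_lt hc, hc.trans_le (hlam.antitone (Nat.zero_le r))⟩, i, ha, rfl,
      by omega⟩

lemma updateBox (ht : IsSVT n lam t) {r c : ℕ} {A : Finset ℕ} (hrc : c < lam r)
    (hA : A.Nonempty) (hbd : ∀ a ∈ A, 1 ≤ a ∧ a ≤ n)
    (hright : ∀ a ∈ A, ∀ b ∈ t r (c + 1), a ≤ b)
    (hbelow : ∀ a ∈ A, ∀ b ∈ t (r + 1) c, a < b)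
    (hleft : ∀ a ∈ A, ∀ c', c' + 1 = c → ∀ b ∈ t r c', b ≤ a)
    (habove : ∀ a ∈ A, ∀ r', r' + 1 = r → ∀ b ∈ t r' c, b < a) :
    IsSVT n lam (updateBox t r c A) where
  boxNonempty r' c' h := by
    unfold SVTCrystal.updateBox
    split_ifs
    · exact hA
    · exact ht.boxNonempty r' c' h
  emptyOutside r' c' h := by
    unfold SVTCrystal.updateBox
    split_ifs with h'
    · obtain ⟨rfl, rfl⟩ := h'
      exact absurd hrc h
    · exact ht.emptyOutside r' c' h
  entryBounds r' c' a ha := by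
    unfold SVTCrystal.updateBox at ha
    split_ifs at ha
    · exact hbd a ha
    · exact ht.entryBounds r' c' a ha
  rowWeak r' c' a b ha hb := by
    unfold SVTCrystal.updateBox at ha hb
    split_ifs at ha hb with h₁ h₂ h₂
    · omega
    · obtain ⟨rfl, rfl⟩ := h₁
      exact hright a ha b hb
    · obtain ⟨rfl, h⟩ := h₂
      exact hleft b hb c' h a ha
    · exact ht.rowWeak r' c' a b ha hb
  colStrict r' c' a b ha hb := by
    unfold SVTCrystal.updateBox at ha hb
    split_ifs at ha hb with h₁ h₂ h₂
    · omega
    · obtain ⟨rfl, rfl⟩ := h₁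
      exact hbelow a ha b hb
    · obtain ⟨h, rfl⟩ := h₂
      exact habove b hb r' h a ha
    · exact ht.colStrict r' c' a b ha hb

lemma Theta_eq_insert (hlam : IsPartitionShape n lam) (ht : IsSVT n lam t)
    (ht' : IsSVT n lam t') {r c i j : ℕ} (hj : j + r = i + c)
    (hoff : ∀ r' c', ¬ (r' = r ∧ c' = c) → t' r' c' = t r' c')
    (hbox : t' r c = insert (i + 1) (t r c)) :
    Theta n lam t' = insert (i + 1, j + 1) (Theta n lam t) := by
  ext ⟨x, y⟩
  rw [Finset.mem_insert, ht.mem_Theta hlam, ht'.mem_Theta hlam]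
  constructor
  · rintro ⟨r', c', hx, hy⟩
    by_cases h : r' = r ∧ c' = c
    · obtain ⟨rfl, rfl⟩ := h
      rw [hbox, Finset.mem_insert] at hx
      rcases hx with rfl | hx
      · left
        ext <;> simp only; omega
      · exact Or.inr ⟨r', c', hx, hy⟩
    · rw [hoff r' c' h] at hx
      exact Or.inr ⟨r', c', hx, hy⟩
  · rintro (h | ⟨r', c', hx, hy⟩)
    · obtain ⟨rfl, rfl⟩ := Prod.mk.inj h
      exact ⟨r, c, by simp [hbox], by omega⟩
    · refine ⟨r', c', ?_, hy⟩
      by_cases h : r' = r ∧ c' = c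
      · obtain ⟨rfl, rfl⟩ := h
        rw [hbox]
        exact Finset.mem_insert_of_mem hx
      · rwa [hoff r' c' h]

lemma Theta_eq_insert_erase (hlam : IsPartitionShape n lam) (ht : IsSVT n lam t)
    (ht' : IsSVT n lam t') {r c i j : ℕ} (hi : i ∈ t r c) (hj : j + r = i + c)
    (hoff : ∀ r' c', ¬ (r' = r ∧ c' = c) → t' r' c' = t r' c')
    (hbox : t' r c = insert (i + 1) ((t r c).erase i)) :
    Theta n lam t' = insert (i + 1, j + 1) ((Theta n lam t).erase (i, j)) := by
  ext ⟨x, y⟩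
  rw [Finset.mem_insert, Finset.mem_erase, ht.mem_Theta hlam, ht'.mem_Theta hlam]
  constructor
  · rintro ⟨r', c', hx, hy⟩
    by_cases h : r' = r ∧ c' = c
    · obtain ⟨rfl, rfl⟩ := h
      rw [hbox, Finset.mem_insert, Finset.mem_erase] at hx
      rcases hx with rfl | ⟨hxi, hx⟩
      · left
        ext <;> simp only; omega
      · exact Or.inr ⟨fun h => hxi (Prod.mk.inj h).1, r', c', hx, hy⟩
    · rw [hoff r' c' h] at hx
      refine Or.inr ⟨fun he => h ?_, r', c', hx, hy⟩
      obtain ⟨rfl, rfl⟩ := Prod.mk.inj he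
      exact ht.diagonal_unique hlam hi hx (by omega)
  · rintro (h | ⟨hne, r', c', hx, hy⟩)
    · obtain ⟨rfl, rfl⟩ := Prod.mk.inj h
      exact ⟨r, c, by simp [hbox], by omega⟩
    · refine ⟨r', c', ?_, hy⟩
      by_cases h : r' = r ∧ c' = c
      · obtain ⟨rfl, rfl⟩ := h
        rw [hbox]
        refine Finset.mem_insert_of_mem (Finset.mem_erase.2 ⟨?_, hx⟩)
        rintro rfl
        exact hne (Prod.ext rfl (by simp only; omega))
      · rwa [hoff r' c' h]

lemma Theta_eq_ydFinset (hlam : IsPartitionShape n lam) (ht : IsSVT n lam t)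
    (hmin : ∀ r c a, a ∈ t r c → a = r + 1) : Theta n lam t = ydFinset n lam := by
  ext ⟨i, j⟩
  rw [ht.mem_Theta hlam]
  simp only [ydFinset, Finset.mem_filter, Finset.mem_product, Finset.mem_Icc]
  constructor
  · rintro ⟨r, c, hi, hj⟩
    obtain rfl := hmin r c i hi
    have hc := ht.col_lt hi
    have h₀ := hlam.antitone (Nat.zero_le r)
    have hr := hlam.row_lt hc
    refine ⟨⟨⟨?_, ?_⟩, ?_, ?_⟩, ?_⟩ <;> (try rw [Nat.add_sub_cancel]) <;> omega
  · rintro ⟨⟨⟨hi, -⟩, hj, -⟩, h⟩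
    obtain ⟨x, hx⟩ := ht.boxNonempty (i - 1) (j - 1) (by omega)
    have := hmin _ _ _ hx
    obtain rfl : x = i := by omega
    exact ⟨_, _, hx, by omega⟩

lemma mem_of_Theta_eq_of_forall_lt (hlam : IsPartitionShape n lam) (ht : IsSVT n lam t)
    (ht' : IsSVT n lam t') (h : Theta n lam t = Theta n lam t') {a j r c : ℕ}
    (hlt : ∀ b k r' c', b < a ∨ b = a ∧ k < j → k + r' = b + c' → (b ∈ t r' c' ↔ b ∈ t' r' c'))
    (hj : j + r = a + c) (ha : a ∈ t r c) : a ∈ t' r c := by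
  have hmem := (ht.mem_Theta hlam).2 ⟨r, c, ha, hj⟩
  rw [h, ht'.mem_Theta hlam] at hmem
  obtain ⟨r', c', ha', hj'⟩ := hmem
  rcases lt_trichotomy r r' with hr | rfl | hr
  · have hc' := ht'.col_lt ha'
    obtain ⟨b, hb⟩ := ht'.boxNonempty (r + 1) c
      ((show c < c' by omega).trans (hc'.trans_le (hlam.antitone hr)))
    have h₁ := ht'.entry_mono hlam hr (show c ≤ c' by omega) (by omega) hb ha'
    have h₂ := ht'.row_lt_entry hlam hb
    have h₃ := (hlt b (b + c - (r + 1)) (r + 1) c (by omega) (by omega)).2 hb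
    have h₄ := ht.colStrict r c a b ha h₃
    omega
  · obtain rfl : c = c' := by omega
    exact ha'
  · have hc := ht.col_lt ha
    obtain ⟨b, hb⟩ := ht.boxNonempty (r' + 1) c'
      ((show c' < c by omega).trans (hc.trans_le (hlam.antitone hr)))
    have h₁ := ht.entry_mono hlam hr (show c' ≤ c by omega) (by omega) hb ha
    have h₂ := ht.row_lt_entry hlam hb
    have h₃ := (hlt b (b + c' - (r' + 1)) (r' + 1) c' (by omega) (by omega)).1 hb
    have h₄ := ht'.colStrict r' c' a b ha' h₃
    omega

lemma Theta_injective (hlam : IsPartitionShape n lam) (ht : IsSVT n lam t)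
    (ht' : IsSVT n lam t') (h : Theta n lam t = Theta n lam t') : t = t' := by
  have key : ∀ a j r c, j + r = a + c → (a ∈ t r c ↔ a ∈ t' r c) := by
    intro a
    induction a using Nat.strong_induction_on with
    | _ a iha =>
    intro j
    induction j using Nat.strong_induction_on with
    | _ j ihj =>
    intro r c hj
    have hlt : ∀ b k r' c', b < a ∨ b = a ∧ k < j → k + r' = b + c' →
        (b ∈ t r' c' ↔ b ∈ t' r' c') := by
      rintro b k r' c' (hb | ⟨rfl, hk⟩) he
      · exact iha b hb k r' c' he
      · exact ihj k hk r' c' he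
    exact ⟨mem_of_Theta_eq_of_forall_lt hlam ht ht' h hlt hj,
      mem_of_Theta_eq_of_forall_lt hlam ht' ht h.symm
        (fun b k r' c' h₁ h₂ => (hlt b k r' c' h₁ h₂).symm) hj⟩
  funext r c
  ext a
  constructor <;> intro ha
  · have := ht.row_lt_entry hlam ha
    exact (key a (a + c - r) r c (by omega)).1 ha
  · have := ht'.row_lt_entry hlam ha
    exact (key a (a + c - r) r c (by omega)).2 ha

end IsSVT

lemma updateBox_self (t : Filling) (r c : ℕ) (A : Finset ℕ) : updateBox t r c A r c = A := by
  simp [updateBox]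

lemma updateBox_of_ne (t : Filling) {r c r' c' : ℕ} (A : Finset ℕ) (h : ¬ (r' = r ∧ c' = c)) :
    updateBox t r c A r' c' = t r' c' := by
  simp only [updateBox, if_neg h]

lemma isSVT_uTab {n : ℕ} {lam : ℕ → ℕ} (hlam : IsPartitionShape n lam) :
    IsSVT n lam (uTab lam) where
  boxNonempty r c h := by simp [uTab, h]
  emptyOutside r c h := by simp [uTab, h]
  entryBounds r c a ha := by
    unfold uTab at ha
    split_ifs at ha with h
    · have := hlam.row_lt h
      rw [Finset.mem_singleton] at ha
      omega
    · simp at ha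
  rowWeak r c a b ha hb := by
    unfold uTab at ha hb
    split_ifs at ha hb <;> simp_all
  colStrict r c a b ha hb := by
    unfold uTab at ha hb
    split_ifs at ha hb <;> simp_all

lemma mem_uTab {lam : ℕ → ℕ} {r c a : ℕ} (ha : a ∈ uTab lam r c) : a = r + 1 := by
  unfold uTab at ha
  split_ifs at ha <;> simp_all

lemma ExcStep.sum_fst_lt {n : ℕ} {E E' : Finset (ℕ × ℕ)} (h : ExcStep n E E') :
    ∑ p ∈ E, p.1 < ∑ p ∈ E', p.1 := by
  obtain ⟨i, j, hij, -, -, -, hnew, rfl | rfl⟩ := h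
  · rw [Finset.sum_insert (fun h => hnew (Finset.mem_of_mem_erase h)),
      ← Finset.add_sum_erase E _ hij]
    simp only
    omega
  · rw [Finset.sum_insert hnew]
    simp only
    omega

/-- Every elementary excitation of `Θ(T)` lifts to a set-valued tableau. -/
lemma IsSVT.exists_of_excStep {n : ℕ} {lam : ℕ → ℕ} {t : Filling} {E : Finset (ℕ × ℕ)}
    (hlam : IsPartitionShape n lam) (ht : IsSVT n lam t) (h : ExcStep n (Theta n lam t) E) :
    ∃ t', IsSVT n lam t' ∧ Theta n lam t' = E := by
  obtain ⟨i, j, hij, hin, hright, hbelow, hnew, hE⟩ := h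
  rw [ht.mem_Theta hlam] at hij hright hbelow hnew
  obtain ⟨r, c, hi, hj⟩ := hij
  have hrc := ht.col_lt hi
  have svt : ∀ A : Finset ℕ, (i + 1) ∈ A → A ⊆ insert (i + 1) (t r c) →
      IsSVT n lam (SVTCrystal.updateBox t r c A) := by
    intro A hA hsub
    have hmem : ∀ a ∈ A, a = i + 1 ∨ a ∈ t r c := fun a ha => by
      simpa using hsub ha
    refine ht.updateBox hrc ⟨_, hA⟩ ?_ ?_ ?_ ?_ ?_
    · intro a ha
      rcases hmem a ha with rfl | ha
      · omega
      · exact ht.entryBounds r c a ha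
    · intro a ha b hb
      rcases hmem a ha with rfl | ha
      · have h₁ := ht.rowWeak r c i b hi hb
        have h₂ : b ≠ i := by
          rintro rfl
          exact hright ⟨r, c + 1, hb, by omega⟩
        omega
      · exact ht.rowWeak r c a b ha hb
    · intro a ha b hb
      rcases hmem a ha with rfl | ha
      · have h₁ := ht.colStrict r c i b hi hb
        have h₂ : b ≠ i + 1 := by
          rintro rfl
          exact hbelow ⟨r + 1, c, hb, by omega⟩
        omega
      · exact ht.colStrict r c a b ha hb
    · rintro a ha c' rfl b hb
      rcases hmem a ha with rfl | ha
      · have := ht.rowWeak r c' b i hb hi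
        omega
      · exact ht.rowWeak r c' b a hb ha
    · rintro a ha r' rfl b hb
      rcases hmem a ha with rfl | ha
      · have := ht.colStrict r' c b i hb hi
        omega
      · exact ht.colStrict r' c b a hb ha
  rcases hE with rfl | rfl
  · have h' := svt (insert (i + 1) ((t r c).erase i)) (Finset.mem_insert_self _ _)
      (Finset.insert_subset_insert _ (Finset.erase_subset _ _))
    exact ⟨_, h', ht.Theta_eq_insert_erase hlam h' hi hj
      (fun _ _ => updateBox_of_ne t _) (updateBox_self t r c _)⟩
  · have h' := svt (insert (i + 1) (t r c)) (Finset.mem_insert_self _ _) subset_rfl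
    exact ⟨_, h', ht.Theta_eq_insert hlam h' hj
      (fun _ _ => updateBox_of_ne t _) (updateBox_self t r c _)⟩

/-- A tableau with an entry that is not minimal for its row arises from an excitation. -/
lemma IsSVT.exists_excStep {n : ℕ} {lam : ℕ → ℕ} {t : Filling} (hlam : IsPartitionShape n lam)
    (ht : IsSVT n lam t) (hex : ∃ a r c, a ∈ t r c ∧ r + 1 < a) :
    ∃ s, IsSVT n lam s ∧ ExcStep n (Theta n lam s) (Theta n lam t) := by
  obtain ⟨a, ⟨hexa, hamin⟩⟩ : ∃ a, (∃ c r, a ∈ t r c ∧ r + 1 < a) ∧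
      ∀ b < a, ¬ ∃ c r, b ∈ t r c ∧ r + 1 < b := by
    have hex' : ∃ a, ∃ c r, a ∈ t r c ∧ r + 1 < a := by
      obtain ⟨a, r, c, h⟩ := hex
      exact ⟨a, c, r, h⟩
    exact ⟨Nat.find hex', Nat.find_spec hex', fun b hb => Nat.find_min hex' hb⟩
  obtain ⟨c, ⟨r, hac, hra⟩, hcmin⟩ : ∃ c, (∃ r, a ∈ t r c ∧ r + 1 < a) ∧
      ∀ d < c, ¬ ∃ r, a ∈ t r d ∧ r + 1 < a :=
    ⟨Nat.find hexa, Nat.find_spec hexa, fun b hb => Nat.find_min hexa hb⟩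
  obtain ⟨i, rfl⟩ : ∃ i, a = i + 1 := ⟨a - 1, by omega⟩
  have hsmall : ∀ {b r' c'}, b ≤ i → r' + 1 < b → b ∉ t r' c' := fun {b r' c'} hb hr hm =>
    hamin b (by omega) ⟨c', r', hm, hr⟩
  have hleft : ∀ {r' c'}, c' < c → r' ≤ r → i + 1 ∉ t r' c' := fun {r' c'} hc hr hm =>
    hcmin c' hc ⟨r', hm, by omega⟩
  have hrc := ht.col_lt hac
  have hbd := ht.entryBounds r c _ hac
  set s := SVTCrystal.updateBox t r c (insert i ((t r c).erase (i + 1))) with hsdef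
  have hsbox : s r c = insert i ((t r c).erase (i + 1)) := updateBox_self t r c _
  have hsoff : ∀ r' c', ¬ (r' = r ∧ c' = c) → s r' c' = t r' c' :=
    fun _ _ => updateBox_of_ne t _
  have hs : IsSVT n lam s := by
    have hmem : ∀ x ∈ insert i ((t r c).erase (i + 1)), x = i ∨ x ∈ t r c := fun x hx => by
      rw [Finset.mem_insert, Finset.mem_erase] at hx
      tauto
    refine ht.updateBox hrc ⟨i, Finset.mem_insert_self _ _⟩ ?_ ?_ ?_ ?_ ?_
    · intro x hx
      rcases hmem x hx with rfl | hx
      · omega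
      · exact ht.entryBounds r c x hx
    · intro x hx b hb
      rcases hmem x hx with rfl | hx
      · have := ht.rowWeak r c _ b hac hb
        omega
      · exact ht.rowWeak r c x b hx hb
    · intro x hx b hb
      rcases hmem x hx with rfl | hx
      · have := ht.colStrict r c _ b hac hb
        omega
      · exact ht.colStrict r c x b hx hb
    · rintro x hx c' rfl b hb
      rcases hmem x hx with rfl | hx
      · have h₁ := ht.rowWeak r c' b _ hb hac
        have h₂ : b ≠ x + 1 := by
          rintro rfl
          exact hleft (Nat.lt_succ_self c') le_rfl hb
        omega
      · exact ht.rowWeak r c' b x hb hx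
    · rintro x hx r' rfl b hb
      rcases hmem x hx with rfl | hx
      · have h₁ := ht.colStrict r' c b _ hb hac
        have h₂ : b ≠ x := by
          rintro rfl
          exact hsmall le_rfl (by omega) hb
        omega
      · exact ht.colStrict r' c b x hb hx
  have his : i ∈ s r c := by simp [hsbox]
  obtain ⟨j, hj⟩ : ∃ j, j + r = i + c := ⟨i + c - r, by omega⟩
  refine ⟨s, hs, i, j, (hs.mem_Theta hlam).2 ⟨r, c, his, hj⟩, hbd.2, ?_, ?_, ?_, ?_⟩
  · rw [hs.mem_Theta hlam]
    rintro ⟨r', c', hm, hd⟩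
    rw [hsoff r' c' (by omega)] at hm
    rcases le_or_gt r r' with hr | hr
    · have := ht.entry_mono hlam hr (show c ≤ c' by omega) (by omega) hac hm
      omega
    · exact hsmall le_rfl (by omega) hm
  · rw [hs.mem_Theta hlam]
    rintro ⟨r', c', hm, hd⟩
    rw [hsoff r' c' (by omega)] at hm
    rcases lt_or_ge r r' with hr | hr
    · have := ht.entry_mono hlam hr.le (show c ≤ c' by omega) (by omega) hac hm
      omega
    · exact hleft (by omega) hr hm
  · rw [hs.mem_Theta hlam]
    rintro ⟨r', c', hm, hd⟩
    by_cases h : r' = r ∧ c' = c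
    · obtain ⟨rfl, rfl⟩ := h
      simp [hsbox] at hm
    · rw [hsoff r' c' h] at hm
      exact h (ht.diagonal_unique hlam hac hm (by omega))
  · have hoff : ∀ r' c', ¬ (r' = r ∧ c' = c) → t r' c' = s r' c' :=
      fun r' c' h => (hsoff r' c' h).symm
    by_cases hi : i ∈ t r c
    · right
      refine hs.Theta_eq_insert hlam ht hj hoff ?_
      ext x
      simp only [hsbox, Finset.mem_insert, Finset.mem_erase]
      by_cases hx : x = i + 1
      · subst hx; simp [hac]
      · by_cases hx' : x = i
        · subst hx'; simp [hi]
        · simp [hx, hx']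
    · left
      refine hs.Theta_eq_insert_erase hlam ht his hj hoff ?_
      ext x
      simp only [hsbox, Finset.mem_insert, Finset.mem_erase]
      by_cases hx : x = i + 1
      · subst hx; simp [hac]
      · by_cases hx' : x = i
        · subst hx'; simp [hi]
        · simp [hx, hx']

lemma IsSVT.Theta_mem_EYD {n : ℕ} {lam : ℕ → ℕ} {t : Filling} (hlam : IsPartitionShape n lam)
    (ht : IsSVT n lam t) : Theta n lam t ∈ EYD n lam := by
  induction hm : ∑ p ∈ Theta n lam t, p.1 using Nat.strong_induction_on generalizing t with
  | _ m ih =>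
  by_cases hex : ∃ a r c, a ∈ t r c ∧ r + 1 < a
  · obtain ⟨s, hs, hstep⟩ := ht.exists_excStep hlam hex
    exact (ih _ (hm ▸ hstep.sum_fst_lt) hs rfl).tail hstep
  · rw [ht.Theta_eq_ydFinset hlam]
    · exact Relation.ReflTransGen.refl
    · intro r c a ha
      have h₁ := ht.row_lt_entry hlam ha
      have h₂ : ¬ r + 1 < a := fun h => hex ⟨a, r, c, ha, h⟩
      omega

lemma exists_isSVT_of_mem_EYD {n : ℕ} {lam : ℕ → ℕ} (hlam : IsPartitionShape n lam)
    {E : Finset (ℕ × ℕ)} (hE : E ∈ EYD n lam) : ∃ t, IsSVT n lam t ∧ Theta n lam t = E := by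
  induction hE with
  | refl =>
    exact ⟨uTab lam, isSVT_uTab hlam,
      (isSVT_uTab hlam).Theta_eq_ydFinset hlam fun _ _ _ => mem_uTab⟩
  | tail _ hstep ih =>
    obtain ⟨t, ht, rfl⟩ := ih
    exact ht.exists_of_excStep hlam hstep

/-- `Θ` is a bijection from `SVT^n(λ)` onto the set `EYD^n(λ)` of excited
Young diagrams of shape `λ`. -/
theorem theta_bijection (n : ℕ) (lam : ℕ → ℕ) (hlam : IsPartitionShape n lam) :
    (∀ t, IsSVT n lam t → Theta n lam t ∈ EYD n lam) ∧
    (∀ t t', IsSVT n lam t → IsSVT n lam t' → Theta n lam t = Theta n lam t' → t = t') ∧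
    (∀ E ∈ EYD n lam, ∃ t, IsSVT n lam t ∧ Theta n lam t = E) :=
  ⟨fun _ ht => ht.Theta_mem_EYD hlam, fun _ _ ht ht' h => ht.Theta_injective hlam ht' h,
    fun _ hE => exists_isSVT_of_mem_EYD hlam hE⟩

end SVTCrystal

end
end

section
/- On the polynomial ring R = ℤ[β][x_1,…,x_n], for 1 ≤ i < n the Demazure–Lascoux operator ϖ_i is well defined (for every f ∈ R, the numerator (x_i + βx_i x_{i+1})·f − (x_{i+1} + βx_i x_{i+1})·(s_i f) is divisible by x_i − x_{i+1}, so ϖ_i maps R to R), and the operators satisfy: ϖ_i² = ϖ_i; ϖ_i ϖ_j = ϖ_j ϖ_i whenever |i − j| > 1; and the braid relation ϖ_i ϖ_{i+1} ϖ_i = ϖ_{i+1} ϖ_i ϖ_{i+1} for 1 ≤ i < n−1. -/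
open scoped Classical

noncomputable section

namespace SVTCrystal

open MvPolynomial in
/-- `x_i - x_{i+1}` divides `f - s_i f`. -/
theorem X_sub_X_dvd_sub_rename_swap (i : ℕ) (f : KPoly) :
    (X i - X (i + 1) : KPoly) ∣ f - rename (Equiv.swap i (i + 1)) f := by
  induction f using MvPolynomial.induction_on with
  | C a => simp
  | add p q hp hq =>
    rw [map_add, add_sub_add_comm]
    exact dvd_add hp hq
  | mul_X p k hp =>
    have hX : (X i - X (i + 1) : KPoly) ∣ X k - X (Equiv.swap i (i + 1) k) := by
      rcases eq_or_ne k i with rfl | hi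
      · simp
      rcases eq_or_ne k (i + 1) with rfl | hi'
      · rw [Equiv.swap_apply_right, dvd_sub_comm]
      · simp [Equiv.swap_apply_of_ne_of_ne hi hi']
    rw [map_mul, rename_X]
    convert dvd_add (hp.mul_right (X k)) (hX.mul_left (rename (Equiv.swap i (i + 1)) p)) using 1
    ring

open MvPolynomial in
/-- The numerator of `ϖ_i f` is divisible by `x_i - x_{i+1}`. -/
theorem X_sub_X_dvd_DLnum (i : ℕ) (f : KPoly) : (X i - X (i + 1) : KPoly) ∣ DLnum i f := by
  have h : DLnum i f = (X i - X (i + 1)) * f +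
      (X (i + 1) + betaP * X i * X (i + 1)) * (f - rename (Equiv.swap i (i + 1)) f) := by
    rw [DLnum]
    ring
  rw [h]
  exact dvd_add (dvd_mul_right _ _) ((X_sub_X_dvd_sub_rename_swap i f).mul_left _)

/-- The Demazure–Lascoux operator `ϖ_i`. -/
def demazureLascoux (i : ℕ) (f : KPoly) : KPoly := (X_sub_X_dvd_DLnum i f).choose

open MvPolynomial in
theorem X_sub_X_mul_demazureLascoux (i : ℕ) (f : KPoly) :
    (X i - X (i + 1)) * demazureLascoux i f =
      (X i + betaP * X i * X (i + 1)) * f -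
        (X (i + 1) + betaP * X i * X (i + 1)) * rename (Equiv.swap i (i + 1)) f :=
  (X_sub_X_dvd_DLnum i f).choose_spec.symm

open MvPolynomial in
theorem X_sub_X_ne_zero {i j : ℕ} (h : i ≠ j) : (X i - X j : KPoly) ≠ 0 :=
  sub_ne_zero.mpr fun e => h (X_injective e)

open MvPolynomial in
/-- The defining equation of `ϖ_i f` after a permutation of the variables. -/
theorem rename_demazureLascoux (σ : Equiv.Perm ℕ) (i : ℕ) (f : KPoly) :
    (X (σ i) - X (σ (i + 1))) * rename σ (demazureLascoux i f) =
      (X (σ i) + betaP * X (σ i) * X (σ (i + 1))) * rename σ f -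
        (X (σ (i + 1)) + betaP * X (σ i) * X (σ (i + 1))) *
          rename (σ * Equiv.swap i (i + 1)) f := by
  have h := congrArg (rename σ) (X_sub_X_mul_demazureLascoux i f)
  simpa [betaP, rename_rename, Equiv.Perm.coe_mul] using h

open MvPolynomial in
theorem rename_swap_demazureLascoux (i : ℕ) (f : KPoly) :
    rename (Equiv.swap i (i + 1)) (demazureLascoux i f) = demazureLascoux i f := by
  apply mul_left_cancel₀ (X_sub_X_ne_zero (Nat.succ_ne_self i).symm)
  have h := rename_demazureLascoux (Equiv.swap i (i + 1)) i f
  rw [Equiv.swap_apply_left, Equiv.swap_apply_right, Equiv.swap_mul_self, Equiv.Perm.coe_one,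
    rename_id_apply] at h
  linear_combination -h - X_sub_X_mul_demazureLascoux i f

theorem demazureLascoux_idem (i : ℕ) (f : KPoly) :
    demazureLascoux i (demazureLascoux i f) = demazureLascoux i f := by
  apply mul_left_cancel₀ (X_sub_X_ne_zero (Nat.succ_ne_self i).symm)
  rw [X_sub_X_mul_demazureLascoux, rename_swap_demazureLascoux]
  ring

open MvPolynomial in
theorem demazureLascoux_comm {i j : ℕ} (hij : i + 1 < j ∨ j + 1 < i) (f : KPoly) :
    demazureLascoux i (demazureLascoux j f) = demazureLascoux j (demazureLascoux i f) := by
  have hcomm : Equiv.swap j (j + 1) * Equiv.swap i (i + 1) =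
      Equiv.swap i (i + 1) * Equiv.swap j (j + 1) :=
    (Equiv.Perm.disjoint_swap_swap (by simp; omega)).commute
  have hi := rename_demazureLascoux (Equiv.swap j (j + 1)) i f
  have hj := rename_demazureLascoux (Equiv.swap i (i + 1)) j f
  rw [Equiv.swap_apply_of_ne_of_ne (by omega) (by omega),
    Equiv.swap_apply_of_ne_of_ne (by omega) (by omega)] at hi hj
  rw [hcomm] at hi
  apply mul_left_cancel₀ (mul_ne_zero (X_sub_X_ne_zero (Nat.succ_ne_self i).symm)
    (X_sub_X_ne_zero (Nat.succ_ne_self j).symm))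
  linear_combination
    (X j - X (j + 1)) * X_sub_X_mul_demazureLascoux i (demazureLascoux j f) +
    (X i + betaP * X i * X (i + 1)) * X_sub_X_mul_demazureLascoux j f -
    (X (i + 1) + betaP * X i * X (i + 1)) * hj -
    (X i - X (i + 1)) * X_sub_X_mul_demazureLascoux j (demazureLascoux i f) -
    (X j + betaP * X j * X (j + 1)) * X_sub_X_mul_demazureLascoux i f +
    (X (j + 1) + betaP * X j * X (j + 1)) * hi

open MvPolynomial in
theorem demazureLascoux_braid (i : ℕ) (f : KPoly) :
    demazureLascoux i (demazureLascoux (i + 1) (demazureLascoux i f)) =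
      demazureLascoux (i + 1) (demazureLascoux i (demazureLascoux (i + 1) f)) := by
  set s := Equiv.swap i (i + 1) with hs
  set t := Equiv.swap (i + 1) (i + 1 + 1) with ht
  have hsa : s i = i + 1 := Equiv.swap_apply_left _ _
  have hsb : s (i + 1) = i := Equiv.swap_apply_right _ _
  have hsc : s (i + 1 + 1) = i + 1 + 1 := Equiv.swap_apply_of_ne_of_ne (by omega) (by omega)
  have hta : t i = i := Equiv.swap_apply_of_ne_of_ne (by omega) (by omega)
  have htb : t (i + 1) = i + 1 + 1 := Equiv.swap_apply_left _ _
  have htc : t (i + 1 + 1) = i + 1 := Equiv.swap_apply_right _ _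
  have hbraid : t * s * t = s * t * s := by
    rw [hs, ht, Equiv.swap_mul_swap_mul_swap (by omega) (by omega), Equiv.swap_comm i (i + 1),
      Equiv.swap_comm (i + 1) (i + 1 + 1), Equiv.swap_mul_swap_mul_swap (by omega) (by omega),
      Equiv.swap_comm]
  have eg := X_sub_X_mul_demazureLascoux i f
  have eg' := X_sub_X_mul_demazureLascoux (i + 1) f
  have etg := rename_demazureLascoux t i f
  have esg' := rename_demazureLascoux s (i + 1) f
  have estg := rename_demazureLascoux (s * t) i f
  have etsg' := rename_demazureLascoux (t * s) (i + 1) f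
  have hg : rename s (demazureLascoux i f) = _ := rename_swap_demazureLascoux i f
  have hg' : rename t (demazureLascoux (i + 1) f) = _ := rename_swap_demazureLascoux (i + 1) f
  set g := demazureLascoux i f
  set g' := demazureLascoux (i + 1) f
  have eh := X_sub_X_mul_demazureLascoux (i + 1) g
  have eh' := X_sub_X_mul_demazureLascoux i g'
  have esh := rename_demazureLascoux s (i + 1) g
  have eth' := rename_demazureLascoux t i g'
  set h := demazureLascoux (i + 1) g
  set h' := demazureLascoux i g'
  have ek := X_sub_X_mul_demazureLascoux i h
  have ek' := X_sub_X_mul_demazureLascoux (i + 1) h'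
  simp only [← hs, ← ht, Equiv.Perm.mul_apply, hsa, hsb, hsc, hta, htb, htc, hbraid, hg, hg']
    at eg eg' etg esg' estg etsg' eh eh' esh eth' ek ek'
  generalize demazureLascoux i h = k at ek ⊢
  generalize demazureLascoux (i + 1) h' = k' at ek' ⊢
  have hab : (X i - X (i + 1) : KPoly) ≠ 0 := X_sub_X_ne_zero (by omega)
  have hbc : (X (i + 1) - X (i + 1 + 1) : KPoly) ≠ 0 := X_sub_X_ne_zero (by omega)
  have hac : (X i - X (i + 1 + 1) : KPoly) ≠ 0 := X_sub_X_ne_zero (by omega)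
  apply mul_left_cancel₀ (mul_ne_zero (mul_ne_zero (pow_ne_zero 2 hab) (pow_ne_zero 2 hbc)) hac)
  generalize (X i : KPoly) = a at *
  generalize (X (i + 1) : KPoly) = b at *
  generalize (X (i + 1 + 1) : KPoly) = c at *
  linear_combination
    (a - b) * (b - c) ^ 2 * (a - c) * ek +
    (a - b) * (b - c) * (a - c) * (a + betaP * a * b) * eh -
    (a - b) * (b - c) ^ 2 * (b + betaP * a * b) * esh +
    ((b - c) * (a - c) * (a + betaP * a * b) * (b + betaP * b * c) -
      (b - c) ^ 2 * (b + betaP * a * b) * (a + betaP * a * c)) * eg -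
    (a - b) * (b - c) * (a + betaP * a * b) * (c + betaP * b * c) * etg +
    (a - b) * (b - c) * (b + betaP * a * b) * (c + betaP * a * c) * estg -
    (b - c) * (a - b) ^ 2 * (a - c) * ek' -
    (a - b) * (b - c) * (a - c) * (b + betaP * b * c) * eh' +
    (b - c) * (a - b) ^ 2 * (c + betaP * b * c) * eth' -
    ((a - b) * (a - c) * (b + betaP * b * c) * (a + betaP * a * b) -
      (a - b) ^ 2 * (c + betaP * b * c) * (a + betaP * a * c)) * eg' +
    (a - b) * (b - c) * (b + betaP * b * c) * (b + betaP * a * b) * esg' -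
    (a - b) * (b - c) * (c + betaP * b * c) * (c + betaP * a * c) * etsg'

/-- the Demazure–Lascoux operators `ϖ_i` (for `1 ≤ i < n`) are well
defined on `ℤ[β][x₁,…,xₙ]` (the defining numerator is divisible by `x_i - x_{i+1}`, which
pins down `ϖ_i` uniquely), satisfy `ϖ_i² = ϖ_i`, commute when `|i-j| > 1`, and satisfy the
braid relations `ϖ_i ϖ_{i+1} ϖ_i = ϖ_{i+1} ϖ_i ϖ_{i+1}`. -/
theorem demazure_lascoux_relations (n : ℕ) :
    ∃ DL : ℕ → KPoly → KPoly,
      IsDLOp n DL ∧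
      (∀ DL', IsDLOp n DL' → ∀ i, 1 ≤ i → i < n → ∀ f, DL' i f = DL i f) ∧
      (∀ i, 1 ≤ i → i < n → ∀ f, DL i (DL i f) = DL i f) ∧
      (∀ i j, 1 ≤ i → i < n → 1 ≤ j → j < n → (i + 1 < j ∨ j + 1 < i) →
        ∀ f, DL i (DL j f) = DL j (DL i f)) ∧
      (∀ i, 1 ≤ i → i + 1 < n →
        ∀ f, DL i (DL (i + 1) (DL i f)) = DL (i + 1) (DL i (DL (i + 1) f))) := by
  refine ⟨demazureLascoux, fun i _ _ f => X_sub_X_mul_demazureLascoux i f, ?_,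
    fun i _ _ f => demazureLascoux_idem i f,
    fun i j _ _ _ _ hij f => demazureLascoux_comm hij f,
    fun i _ _ f => demazureLascoux_braid i f⟩
  intro DL' hDL' i hi hin f
  apply mul_left_cancel₀ (X_sub_X_ne_zero (Nat.succ_ne_self i).symm)
  rw [hDL' i hi hin f, X_sub_X_mul_demazureLascoux, DLnum]

end SVTCrystal

end
end
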